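/- For every integer k ≥ 2 and every integer r ≥ 1, one can write F^(k)_r = f_k(α) α^{r−1} (1 + X_r) where X_r is a real number with |X_r| < 2/α^r; equivalently, |F^(k)_r / (f_k(α) α^{r−1}) − 1| < 2/α^r. -/

import Mathlib

/-- `kfib k j` is the `k`-generalized Fibonacci number `F⁽ᵏ⁾_n` with shifted index
`j = n + k - 2` (so `j = 0` corresponds to `n = 2 - k`).  Thus `kfib k j = 0` for
`0 ≤ j ≤ k - 2` (these are `F⁽ᵏ⁾_{2-k} = ⋯ = F⁽ᵏ⁾_0 = 0`), `kfib k (k - 1) = 1`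
(this is `F⁽ᵏ⁾_1 = 1`), and every later term is the sum of the preceding `k` terms
(junk value `0` if `k < 2`). -/
def kfib (k : ℕ) : ℕ → ℤ
  | j =>
    if k < 2 then 0
    else if j < k - 1 then 0
    else if j = k - 1 then 1
    else ∑ i ∈ Finset.range k, kfib k (j - 1 - i)
decreasing_by omega

theorem kfib_of_lt {k j : ℕ} (hj : j < k - 1) : kfib k j = 0 := by
  rw [kfib]
  simp [hj]

theorem kfib_pred {k : ℕ} (hk : 2 ≤ k) : kfib k (k - 1) = 1 := by
  rw [kfib]
  simp [not_lt.mpr hk]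

theorem kfib_add {k : ℕ} (hk : 2 ≤ k) (j : ℕ) :
    kfib k (j + k) = ∑ i ∈ Finset.range k, kfib k (j + i) := by
  rw [kfib, if_neg (by omega), if_neg (by omega), if_neg (by omega),
    ← Finset.sum_range_reflect]
  refine Finset.sum_congr rfl fun i hi => ?_
  rw [Finset.mem_range] at hi
  congr 1
  omega

/-- A solution of the `k`-step recurrence satisfies a three-term recurrence. -/
theorem kstep_three_term {k : ℕ} {E : ℕ → ℝ}
    (hE : ∀ j, E (j + k) = ∑ i ∈ Finset.range k, E (j + i)) (j : ℕ) :
    E (j + k + 1) = 2 * E (j + k) - E j := by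
  have h1 := hE (j + 1)
  have h2 := Finset.sum_range_succ (fun i => E (j + i)) k
  rw [Finset.sum_range_succ', ← hE j] at h2
  have h3 : ∑ i ∈ Finset.range k, E (j + 1 + i) = ∑ i ∈ Finset.range k, E (j + (i + 1)) :=
    Finset.sum_congr rfl fun i _ => by congr 1; omega
  rw [show j + k + 1 = j + 1 + k by omega, h1, h3]
  simp only [add_zero] at h2
  linarith

/-- A solution of the `k`-step recurrence that is annihilated by a positive linear functional on
windows of length `k` never reaches a level exceeding all of its initial values. -/
theorem kstep_lt_of_initial_lt {k : ℕ} (hk : 0 < k) {E c : ℕ → ℝ} {b : ℝ} (hb : 0 < b)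
    (hE : ∀ j, E (j + k) = ∑ i ∈ Finset.range k, E (j + i)) (hc : ∀ i, 0 < c i)
    (hV : ∀ j, ∑ i ∈ Finset.range k, c i * E (j + i) = 0) (h0 : ∀ j < k, E j < b) (j : ℕ) :
    E j < b := by
  classical
  by_contra hj
  have hex : ∃ n, ¬ E n < b := ⟨j, hj⟩
  obtain ⟨N, hN, hmin⟩ : ∃ N, b ≤ E N ∧ ∀ i < N, E i < b :=
    ⟨Nat.find hex, not_lt.mp (Nat.find_spec hex), fun i hi => not_not.mp (Nat.find_min hex hi)⟩
  have hkN : k ≤ N := by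
    by_contra! h
    exact absurd (h0 N h) (not_lt.mpr hN)
  have key : ∀ m, b ≤ E (N + m) ∧ ∀ i < N + m, E i < E (N + m) := by
    intro m
    induction m with
    | zero => exact ⟨hN, fun i hi => (hmin i hi).trans_le hN⟩
    | succ m ih =>
      have h := kstep_three_term hE (N + m - k)
      rw [Nat.sub_add_cancel (by omega)] at h
      have h' := ih.2 (N + m - k) (by omega)
      have hlt : E (N + m) < E (N + (m + 1)) := by
        rw [← add_assoc, h]; linarith
      refine ⟨ih.1.trans hlt.le, fun i hi => ?_⟩
      rcases (show i < N + m ∨ i = N + m by omega) with hi | rfl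
      · exact (ih.2 i hi).trans hlt
      · exact hlt
  refine (Finset.sum_pos (fun i _ => mul_pos (hc i) (hb.trans_le (key i).1)) ?_).ne' (hV N)
  exact Finset.nonempty_range_iff.mpr hk.ne'

/-- The functional with weights `1 - α⁻¹ ^ (i + 1)` on windows of length `k` is an eigenfunctional
of the shift for the `k`-step recurrence, with eigenvalue `α`. -/
theorem kstep_functional_succ {k : ℕ} {α : ℝ} (hα : 0 < α) (hroot : 1 - α⁻¹ ^ k = α - 1)
    {E : ℕ → ℝ} (hE : ∀ j, E (j + k) = ∑ i ∈ Finset.range k, E (j + i)) (j : ℕ) :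
    ∑ i ∈ Finset.range k, (1 - α⁻¹ ^ (i + 1)) * E (j + 1 + i) =
      α * ∑ i ∈ Finset.range k, (1 - α⁻¹ ^ (i + 1)) * E (j + i) := by
  have h1 := Finset.sum_range_succ (fun i => (1 - α⁻¹ ^ i) * E (j + i)) k
  rw [Finset.sum_range_succ', hroot, hE j] at h1
  have h2 : ∑ i ∈ Finset.range k, (1 - α⁻¹ ^ i) * E (j + i) =
      α * ∑ i ∈ Finset.range k, (1 - α⁻¹ ^ (i + 1)) * E (j + i) -
        (α - 1) * ∑ i ∈ Finset.range k, E (j + i) := by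
    rw [Finset.mul_sum, Finset.mul_sum, ← Finset.sum_sub_distrib]
    refine Finset.sum_congr rfl fun i _ => ?_
    have : α * α⁻¹ ^ (i + 1) = α⁻¹ ^ i := by
      rw [pow_succ', mul_inv_cancel_left₀ hα.ne']
    linear_combination E (j + i) * this
  have h3 : ∑ i ∈ Finset.range k, (1 - α⁻¹ ^ (i + 1)) * E (j + 1 + i) =
      ∑ i ∈ Finset.range k, (1 - α⁻¹ ^ (i + 1)) * E (j + (i + 1)) :=
    Finset.sum_congr rfl fun i _ => by rw [add_right_comm, add_assoc]
  simp only [pow_zero, sub_self, zero_mul, add_zero] at h1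
  rw [h3, h1, h2]
  ring

section Root

variable {k : ℕ} {α : ℝ}

theorem two_sub_mul_pow_eq_one (hroot : α ^ k = ∑ i ∈ Finset.range k, α ^ i) :
    (2 - α) * α ^ k = 1 := by
  have h := geom_sum_mul α k
  rw [← hroot] at h
  linarith

theorem lt_two_of_root (hα : 1 < α) (hroot : α ^ k = ∑ i ∈ Finset.range k, α ^ i) : α < 2 := by
  have h := two_sub_mul_pow_eq_one hroot
  have hp : 0 < α ^ k := by positivity
  by_contra! h2
  nlinarith

theorem succ_mul_lt_two_mul_pow (hk : 2 ≤ k) (hα : 1 < α)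
    (hroot : α ^ k = ∑ i ∈ Finset.range k, α ^ i) : (k + 1) * α < 2 * α ^ k := by
  have h2 := lt_two_of_root hα hroot
  obtain ⟨m, rfl⟩ : ∃ m, k = m + 2 := ⟨k - 2, by omega⟩
  have h : ((m + 1 : ℕ) : ℝ) * α ≤ ∑ i ∈ Finset.range (m + 1), α ^ (i + 1) := by
    have := Finset.card_nsmul_le_sum (Finset.range (m + 1)) (fun i => α ^ (i + 1)) α
      fun i _ => le_self_pow₀ hα.le (by omega)
    simpa using this
  rw [hroot, Finset.sum_range_succ']
  push_cast at h ⊢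
  have : 0 ≤ (m : ℝ) * α := by positivity
  nlinarith

/-- The denominator of `f_k(α)` is positive and `1 / 2 < f_k(α) < α / 2`. -/
theorem coeff_bounds (hk : 2 ≤ k) (hα : 1 < α)
    (hroot : α ^ k = ∑ i ∈ Finset.range k, α ^ i) :
    0 < 2 + (k + 1) * (α - 2) ∧ 1 / 2 < (α - 1) / (2 + (k + 1) * (α - 2)) ∧
      (α - 1) / (2 + (k + 1) * (α - 2)) < α / 2 := by
  have h2 := lt_two_of_root hα hroot
  have hk' : (2 : ℝ) ≤ k := by exact_mod_cast hk
  have hδ : (k + 1) * (2 - α) * α < 2 := by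
    have h := mul_lt_mul_of_pos_left (succ_mul_lt_two_mul_pow hk hα hroot) (sub_pos.mpr h2)
    linear_combination h + 2 * two_sub_mul_pow_eq_one hroot
  have hδ0 : 0 < (k + 1) * (2 - α) := mul_pos (by positivity) (sub_pos.mpr h2)
  have hD : 0 < 2 + (k + 1) * (α - 2) := by nlinarith
  refine ⟨hD, ?_, ?_⟩
  · rw [div_lt_div_iff₀ two_pos hD]
    nlinarith
  · rw [div_lt_div_iff₀ hD two_pos]
    nlinarith

/-- The error of the approximation of `F⁽ᵏ⁾` by its dominant term is less than `1 / 2`. -/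
theorem abs_kfib_sub_lt_half (hk : 2 ≤ k) (hα : 1 < α)
    (hroot : α ^ k = ∑ i ∈ Finset.range k, α ^ i) (j : ℕ) :
    |(kfib k j : ℝ) - (α - 1) / (2 + (k + 1) * (α - 2)) / α ^ (k - 1) * α ^ j| < 1 / 2 := by
  obtain ⟨hD, hf1, hf2⟩ := coeff_bounds hk hα hroot
  have hα2 := lt_two_of_root hα hroot
  have hα0 : 0 < α := by linarith
  have hδ := two_sub_mul_pow_eq_one hroot
  set f := (α - 1) / (2 + (k + 1) * (α - 2))
  have hfD : f * (2 + (k + 1) * (α - 2)) = α - 1 := div_mul_cancel₀ _ hD.ne'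
  have hinv : 1 - α⁻¹ ^ k = α - 1 := by
    rw [inv_pow, ← eq_inv_of_mul_eq_one_left hδ]; ring
  have hpk : α ^ k = α ^ (k - 1) * α := by rw [← pow_succ, Nat.sub_add_cancel (by omega)]
  set E : ℕ → ℝ := fun j => (kfib k j : ℝ) - f / α ^ (k - 1) * α ^ j with hEdef
  have hE : ∀ j, E (j + k) = ∑ i ∈ Finset.range k, E (j + i) := by
    intro j
    simp only [hEdef, kfib_add hk j, Finset.sum_sub_distrib, ← Finset.mul_sum, pow_add, ← hroot]
    push_cast
    rfl
  have hE0 : ∀ j < k - 1, E j = -(f / α ^ (k - 1) * α ^ j) := by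
    intro j hj
    simp [hEdef, kfib_of_lt hj]
  have hE1 : E (k - 1) = 1 - f := by
    simp only [hEdef, kfib_pred hk]
    rw [div_mul_cancel₀ _ (by positivity)]
    simp
  have hV0 : ∑ i ∈ Finset.range k, (1 - α⁻¹ ^ (i + 1)) * E (0 + i) = 0 := by
    have hF : ∑ i ∈ Finset.range k, (1 - α⁻¹ ^ (i + 1)) * (kfib k i : ℝ) = α - 1 := by
      rw [Finset.sum_eq_single (k - 1)]
      · rw [kfib_pred hk, Nat.sub_add_cancel (by omega), hinv]; simp
      · intro i hi hne
        rw [Finset.mem_range] at hi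
        rw [kfib_of_lt (by omega)]; simp
      · intro h
        exact absurd (Finset.mem_range.mpr (by omega)) h
    have hG : ∑ i ∈ Finset.range k, (1 - α⁻¹ ^ (i + 1)) * α ^ i = α ^ k - k * α⁻¹ := by
      have : ∀ i, (1 - α⁻¹ ^ (i + 1)) * α ^ i = α ^ i - α⁻¹ := by
        intro i
        have : α⁻¹ ^ i * α ^ i = 1 := by rw [← mul_pow, inv_mul_cancel₀ hα0.ne', one_pow]
        linear_combination -α⁻¹ * this
      simp only [this, Finset.sum_sub_distrib, ← hroot]
      simp
    have hsplit : ∀ i, (1 - α⁻¹ ^ (i + 1)) * E (0 + i) = (1 - α⁻¹ ^ (i + 1)) * (kfib k i : ℝ) -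
        f / α ^ (k - 1) * ((1 - α⁻¹ ^ (i + 1)) * α ^ i) := by
      intro i
      simp only [hEdef, zero_add]
      ring
    simp only [hsplit, Finset.sum_sub_distrib, ← Finset.mul_sum, hF, hG]
    rw [hpk] at hδ ⊢
    field_simp
    linear_combination (-α * α ^ (k - 1)) * hfD - f * k * hδ
  have hV : ∀ j, ∑ i ∈ Finset.range k, (1 - α⁻¹ ^ (i + 1)) * E (j + i) = 0 := by
    intro j
    induction j with
    | zero => exact hV0
    | succ j ih => rw [kstep_functional_succ hα0 hinv hE, ih, mul_zero]
  have hc : ∀ i : ℕ, 0 < 1 - α⁻¹ ^ (i + 1) := fun i =>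
    sub_pos.mpr (pow_lt_one₀ (by positivity) (inv_lt_one_of_one_lt₀ hα) (by omega))
  have hinit : ∀ j < k, |E j| < 1 / 2 := by
    intro j hj
    rcases (show j < k - 1 ∨ j = k - 1 by omega) with hj | rfl
    · have hfpos : 0 < f := by linarith
      rw [hE0 j hj, abs_neg, abs_of_pos (by positivity), div_mul_eq_mul_div,
        div_lt_iff₀ (by positivity)]
      have h1 : α ^ j * α ≤ α ^ (k - 1) := by
        rw [← pow_succ]
        exact pow_le_pow_right₀ hα.le (by omega)
      have h2 : 0 < α ^ j := by positivity
      nlinarith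
    · rw [hE1, abs_lt]
      constructor <;> linarith
  refine abs_lt.mpr ⟨?_, ?_⟩
  · have h := kstep_lt_of_initial_lt (k := k) (E := fun j => -E j) (by omega) one_half_pos
      (fun j => by rw [hE j, Finset.sum_neg_distrib]) hc
      (fun j => by simp only [mul_neg, Finset.sum_neg_distrib, hV j, neg_zero])
      (fun j hj => by linarith [(abs_lt.mp (hinit j hj)).1]) j
    exact neg_lt.mp h
  · exact kstep_lt_of_initial_lt (by omega) one_half_pos hE hc hV
      (fun j hj => (abs_lt.mp (hinit j hj)).2) j

end Root

/-- For `k ≥ 2` and `r ≥ 1` one can write `F⁽ᵏ⁾_r = f_k(α) α^(r-1) (1 + X_r)` with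
`|X_r| < 2 / α^r`, where `α` is the dominant root of `Ψₖ` and
`f_k(z) = (z - 1)/(2 + (k+1)(z - 2))`. -/
theorem kfib_relative_error (k r : ℕ) (hk : 2 ≤ k) (hr : 1 ≤ r) (α : ℝ) (hα : 1 < α)
    (hroot : α ^ k = ∑ i ∈ Finset.range k, α ^ i) :
    ∃ X : ℝ, |X| < 2 / α ^ r ∧
      (kfib k (r + k - 2) : ℝ) =
        (α - 1) / (2 + (k + 1) * (α - 2)) * α ^ (r - 1) * (1 + X) := by
  obtain ⟨-, hf1, -⟩ := coeff_bounds hk hα hroot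
  have hα2 := lt_two_of_root hα hroot
  have h := abs_kfib_sub_lt_half hk hα hroot (r + k - 2)
  set f := (α - 1) / (2 + (k + 1) * (α - 2))
  have hr' : α ^ r = α ^ (r - 1) * α := by rw [← pow_succ, Nat.sub_add_cancel hr]
  rw [show r + k - 2 = (k - 1) + (r - 1) by omega, pow_add, ← mul_assoc,
    div_mul_cancel₀ _ (by positivity)] at h
  rw [show r + k - 2 = (k - 1) + (r - 1) by omega]
  have hp : 0 < α ^ (r - 1) := by positivity
  have hfp : 0 < f * α ^ (r - 1) := mul_pos (by linarith) hp
  refine ⟨((kfib k (k - 1 + (r - 1)) : ℝ) - f * α ^ (r - 1)) / (f * α ^ (r - 1)), ?_, ?_⟩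
  · rw [abs_div, abs_of_pos hfp, div_lt_div_iff₀ hfp (by positivity), hr']
    have : |(kfib k (k - 1 + (r - 1)) : ℝ) - f * α ^ (r - 1)| * α < 2 * f := by nlinarith
    nlinarith
  · field_simp
    ring
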